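/- arXiv:2112.06283 — 3 statements merged into one kernel-verified Lean document; each statement's English description precedes it below -/
import Mathlib

section
/- Let Π be a Borel probability measure on ℝ, x0 ∈ ℝ, Δ > 0 and c ∈ (0,2). Let M = {θ ∈ ℝ : x0 + θ < 0 and x0 + Δ + θ ≥ 0} and πM = Π(M), and assume πM < 1. Set q = min(πM(2 − c)/(c(1 − πM)), 1) and define p : ℝ → [0,1] by p(θ) = 1 if θ ∈ M and p(θ) = q otherwise. Then ∫ p(θ)·((sign(x0 + Δ + θ) − c) − sign(x0 + θ)) dΠ(θ) ≥ 0; that is, conditional on the recommendation to act, the decision subject weakly prefers taking the action. -/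
open MeasureTheory Classical

/-- `sign(t) = 1` if `t ≥ 0` and `-1` otherwise. -/
noncomputable def sgn (t : ℝ) : ℝ := if 0 ≤ t then 1 else -1

/-- Conditional on the recommendation to act (sent with probability `1` on `M` and
probability `q` elsewhere), the decision subject weakly prefers taking action `a₁`. -/
theorem stmt_0 (μ : Measure ℝ) [IsProbabilityMeasure μ]
    (x0 Δ c : ℝ) (hΔ : 0 < Δ) (hc0 : 0 < c) (hc2 : c < 2)
    (M : Set ℝ) (hM : M = {θ : ℝ | x0 + θ < 0 ∧ 0 ≤ x0 + Δ + θ})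
    (πM : ℝ) (hπM : πM = (μ M).toReal) (hπM1 : πM < 1)
    (q : ℝ) (hq : q = min (πM * (2 - c) / (c * (1 - πM))) 1)
    (p : ℝ → ℝ) (hp : ∀ θ, p θ = if θ ∈ M then 1 else q) :
    0 ≤ ∫ θ, p θ * ((sgn (x0 + Δ + θ) - c) - sgn (x0 + θ)) ∂μ := by
  have hMm : MeasurableSet M := by
    rw [hM]
    measurability
  have hfun : (fun θ => p θ * ((sgn (x0 + Δ + θ) - c) - sgn (x0 + θ))) =
      fun θ => M.indicator (fun _ => 2 - c) θ + Mᶜ.indicator (fun _ => -(q * c)) θ := by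
    funext θ
    by_cases hθ : θ ∈ M
    · have hmem : x0 + θ < 0 ∧ 0 ≤ x0 + Δ + θ := by simpa [hM] using hθ
      simp only [hp, hθ, sgn, if_true, Set.indicator_of_mem, Set.mem_compl_iff, not_true_eq_false,
        not_false_eq_true, Set.indicator_of_notMem, hmem.2, not_le.mpr hmem.1, if_false]
      ring
    · have hmem : ¬ (x0 + θ < 0 ∧ 0 ≤ x0 + Δ + θ) := by simpa [hM] using hθ
      have hsgn : sgn (x0 + Δ + θ) = sgn (x0 + θ) := by
        unfold sgn
        split_ifs <;> grind
      simp only [hp, hθ, hsgn, if_false, Set.indicator_of_notMem, Set.mem_compl_iff,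
        not_false_eq_true, Set.indicator_of_mem]
      ring
  have hcompl : μ.real Mᶜ = 1 - πM := by
    rw [probReal_compl_eq_one_sub hMm, hπM, measureReal_def]
  rw [hfun, integral_add ((integrable_const _).indicator hMm)
    ((integrable_const _).indicator hMm.compl), integral_indicator_const _ hMm,
    integral_indicator_const _ hMm.compl, hcompl, measureReal_def, ← hπM, smul_eq_mul, smul_eq_mul]
  have hq_le : q ≤ πM * (2 - c) / (c * (1 - πM)) := hq ▸ min_le_left _ _
  rw [le_div_iff₀ (mul_pos hc0 (sub_pos.mpr hπM1))] at hq_le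
  linarith
end

section
/- For every ε ∈ (0,1) there exist x0 ∈ ℝ, Δ > 0, c ∈ (0,2), a Borel probability measure Π on ℝ, and a measurable function p : ℝ → [0,1] such that, with u1(θ) = sign(x0 + Δ + θ) − c, u0(θ) = sign(x0 + θ), and M = {θ : x0 + θ < 0 and x0 + Δ + θ ≥ 0}: (i) the signaling policy that recommends a1 with probability p(θ) is Bayesian incentive-compatible, i.e. ∫ p(θ)(u1(θ) − u0(θ)) dΠ ≥ 0 and ∫ (1 − p(θ))(u0(θ) − u1(θ)) dΠ ≥ 0; (ii) the decision maker's expected utility from signaling satisfies ∫ p(θ) dΠ(θ) = 1 − ε; (iii) the decision maker's expected utility from revealing full information satisfies Π(M) ≤ ε; and (iv) ∫ (u1(θ) − u0(θ)) dΠ < 0, so that under no information the decision subject takes a_∅ and the decision maker's expected utility from revealing no information is 0. -/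
open MeasureTheory

/-- The measure on `ℝ` with atoms at `-1/2`, `0` and `1` of masses `a`, `b` and `d`. -/
noncomputable def threeAtoms (a b d : ℝ) : Measure ℝ :=
  ENNReal.ofReal a • Measure.dirac (-1 / 2) + ENNReal.ofReal b • Measure.dirac 0 +
    ENNReal.ofReal d • Measure.dirac 1

theorem integral_threeAtoms {a b d : ℝ} (ha : 0 ≤ a) (hb : 0 ≤ b) (hd : 0 ≤ d) (f : ℝ → ℝ) :
    ∫ θ, f θ ∂threeAtoms a b d = a * f (-1 / 2) + b * f 0 + d * f 1 := by
  have hint (w x : ℝ) : Integrable f (ENNReal.ofReal w • Measure.dirac x) :=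
    (integrable_dirac (by simp)).smul_measure ENNReal.ofReal_ne_top
  rw [threeAtoms, integral_add_measure ((hint _ _).add_measure (hint _ _)) (hint _ _),
    integral_add_measure (hint _ _) (hint _ _)]
  simp [integral_smul_measure, ENNReal.toReal_ofReal, ha, hb, hd]

theorem isProbabilityMeasure_threeAtoms {a b d : ℝ} (ha : 0 ≤ a) (hb : 0 ≤ b) (hd : 0 ≤ d)
    (h : a + b + d = 1) : IsProbabilityMeasure (threeAtoms a b d) := by
  constructor
  simp [threeAtoms, ← ENNReal.ofReal_add, add_nonneg, ha, hb, hd, h]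

/-- For every `ε ∈ (0,1)` there is a problem instance and a BIC signaling policy whose
expected decision-maker utility is `1 − ε`, while revealing full information yields at
most `ε` and revealing no information yields `0` (the subject prefers `a_∅` under the
prior). -/
theorem stmt_4 (ε : ℝ) (hε0 : 0 < ε) (hε1 : ε < 1) :
    ∃ (x0 Δ c : ℝ) (μ : Measure ℝ) (p : ℝ → ℝ),
      IsProbabilityMeasure μ ∧ 0 < Δ ∧ 0 < c ∧ c < 2 ∧
      Measurable p ∧ (∀ θ, 0 ≤ p θ ∧ p θ ≤ 1) ∧
      -- (i) Bayesian incentive-compatibility of the signaling policy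
      (0 ≤ ∫ θ, p θ * ((sgn (x0 + Δ + θ) - c) - sgn (x0 + θ)) ∂μ) ∧
      (0 ≤ ∫ θ, (1 - p θ) * (sgn (x0 + θ) - (sgn (x0 + Δ + θ) - c)) ∂μ) ∧
      -- (ii) expected decision-maker utility from signaling is `1 − ε`
      (∫ θ, p θ ∂μ) = 1 - ε ∧
      -- (iii) expected decision-maker utility from full information is at most `ε`
      (μ {θ : ℝ | x0 + θ < 0 ∧ 0 ≤ x0 + Δ + θ}).toReal ≤ ε ∧
      -- (iv) under no information the subject strictly prefers `a_∅`
      (∫ θ, (sgn (x0 + Δ + θ) - c) - sgn (x0 + θ) ∂μ) < 0 := by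
  have ha : 0 ≤ ε * (1 - ε) := mul_nonneg hε0.le (by linarith)
  have hb : 0 ≤ (1 - ε) ^ 2 := sq_nonneg _
  refine ⟨0, 1, 2 * ε, threeAtoms (ε * (1 - ε)) ((1 - ε) ^ 2) ε,
    fun θ => if θ < 1 / 2 then 1 else 0,
    isProbabilityMeasure_threeAtoms ha hb hε0.le (by ring), one_pos, by linarith, by linarith,
    Measurable.ite measurableSet_Iio measurable_const measurable_const,
    fun θ => by dsimp only; split_ifs <;> norm_num, ?_, ?_, ?_, ?_, ?_⟩
  · rw [integral_threeAtoms ha hb hε0.le]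
    norm_num [sgn]
    nlinarith
  · rw [integral_threeAtoms ha hb hε0.le]
    norm_num [sgn]
    nlinarith
  · rw [integral_threeAtoms ha hb hε0.le]
    norm_num
    ring
  · norm_num [threeAtoms, Measure.dirac_apply, Set.indicator, ENNReal.toReal_ofReal ha]
    nlinarith
  · rw [integral_threeAtoms ha hb hε0.le]
    norm_num [sgn]
    nlinarith
end

section
/- Fix a finite action set A with |A| = m ≥ 1, a finite set ℛ of equivalence regions, a prior p : ℛ → [0,1] with Σ_{R ∈ ℛ} p(R) = 1, decision-subject utilities u_ds : A × ℛ → ℝ, decision-maker utilities u_dm : A → [0,1], and ε > 0. For any feasible BIC signaling policy q (i.e., q : A × ℛ → [0,1] with Σ_a q(a, R) = 1 for every R and Σ_R q(a, R) p(R)(u_ds(a, R) − u_ds(a', R)) ≥ 0 for all a, a'), there exists a feasible BIC signaling policy q̃ such that: (i) Σ_a Σ_R p(R) q̃(a, R) u_dm(a) ≥ Σ_a Σ_R p(R) q(a, R) u_dm(a) − ε/2, and (ii) every signal is large or honest: for each a ∈ A, either Σ_R q̃(a, R) p(R) > ε/(2m), or for every R with q̃(a, R) > 0 one has u_ds(a,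 R) ≥ u_ds(a', R) for all a' ∈ A. In particular, there exists an (ε/2)-optimal BIC signaling policy in which every signal is large or honest. -/
/-- For every feasible BIC signaling policy `q` there is a feasible BIC signaling policy
`q̃` losing at most `ε/2` in the decision maker's objective, in which every signal is
either *large* (total probability exceeding `ε/(2m)`) or *honest* (only sent on regions
where the recommended action maximizes the decision subject's utility). In particular,
an `(ε/2)`-optimal BIC signaling policy exists in which every signal is large or
honest. -/
theorem stmt_11 {A R : Type*} [Fintype A] [Fintype R]
    (m : ℕ) (hm : Fintype.card A = m) (hm1 : 1 ≤ m)
    (p : R → ℝ) (hp0 : ∀ r, 0 ≤ p r) (hp1 : ∑ r, p r = 1)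
    (uds : A → R → ℝ) (udm : A → ℝ) (hudm : ∀ a, udm a ∈ Set.Icc (0 : ℝ) 1)
    (ε : ℝ) (hε : 0 < ε)
    (q : A → R → ℝ) (hq01 : ∀ a r, q a r ∈ Set.Icc (0 : ℝ) 1)
    (hqsum : ∀ r, ∑ a, q a r = 1)
    (hBIC : ∀ a a', 0 ≤ ∑ r, q a r * p r * (uds a r - uds a' r)) :
    ∃ qt : A → R → ℝ,
      (∀ a r, qt a r ∈ Set.Icc (0 : ℝ) 1) ∧
      (∀ r, ∑ a, qt a r = 1) ∧
      (∀ a a', 0 ≤ ∑ r, qt a r * p r * (uds a r - uds a' r)) ∧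
      ((∑ a, ∑ r, p r * q a r * udm a) - ε / 2 ≤ ∑ a, ∑ r, p r * qt a r * udm a) ∧
      (∀ a, (ε / (2 * m) < ∑ r, qt a r * p r) ∨
        (∀ r, 0 < qt a r → ∀ a', uds a' r ≤ uds a r)) := by
  classical
  have hA : Nonempty A := Fintype.card_pos_iff.mp (by omega)
  choose b hb using fun r => Finite.exists_max (fun a => uds a r)
  set S : A → Prop := fun a => ∑ r, q a r * p r ≤ ε / (2 * m) with hS
  -- `k` keeps the large signals of `q`; `t r` is the mass of small signals at `r`,
  -- which is moved to the honest action `b r`.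
  let k : A → R → ℝ := fun a r => if S a then 0 else q a r
  let t : R → ℝ := fun r => ∑ a, if S a then q a r else 0
  have hk0 : ∀ a r, 0 ≤ k a r := fun a r => by
    simp only [k]; split_ifs
    exacts [le_rfl, (hq01 a r).1]
  have ht0 : ∀ r, 0 ≤ t r := fun r => Finset.sum_nonneg fun a _ => by
    split_ifs
    exacts [(hq01 a r).1, le_rfl]
  let h : A → R → ℝ := fun a r => if a = b r then t r else 0
  have hh0 : ∀ a r, 0 ≤ h a r := fun a r => by
    simp only [h]; split_ifs
    exacts [ht0 r, le_rfl]
  have hsum : ∀ r, ∑ a, (k a r + h a r) = 1 := fun r => by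
    rw [Finset.sum_add_distrib]
    have h1 : ∑ a, h a r = t r := by simp [h]
    rw [h1, ← Finset.sum_add_distrib, ← hqsum r]
    refine Finset.sum_congr rfl fun a _ => ?_
    simp only [k]; split_ifs <;> simp
  refine ⟨fun a r => k a r + h a r, fun a r => ⟨add_nonneg (hk0 a r) (hh0 a r), ?_⟩, hsum,
    fun a a' => ?_, ?_, fun a => ?_⟩
  · rw [← hsum r]
    exact Finset.single_le_sum (f := fun a => k a r + h a r)
      (fun a _ => add_nonneg (hk0 a r) (hh0 a r)) (Finset.mem_univ a)
  · simp only [add_mul, Finset.sum_add_distrib]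
    refine add_nonneg ?_ (Finset.sum_nonneg fun r _ => ?_)
    · by_cases ha : S a
      · simp [k, ha]
      · simpa [k, ha] using hBIC a a'
    · by_cases hab : a = b r
      · exact mul_nonneg (mul_nonneg (hh0 a r) (hp0 r)) (sub_nonneg.2 (hab ▸ hb r a'))
      · simp [h, hab]
  · have hloss : ∀ a, (∑ r, p r * q a r * udm a) - ε / (2 * m)
        ≤ ∑ r, p r * (k a r + h a r) * udm a := fun a => by
      have hu := hudm a
      have hm0 : 0 ≤ ε / (2 * m) := by positivity
      by_cases ha : S a
      · have h1 : ∑ r, p r * q a r * udm a ≤ ∑ r, q a r * p r :=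
          Finset.sum_le_sum fun r _ => by
            have := mul_le_of_le_one_right (mul_nonneg (hp0 r) (hq01 a r).1) hu.2
            linarith
        have h2 : 0 ≤ ∑ r, p r * (k a r + h a r) * udm a :=
          Finset.sum_nonneg fun r _ =>
            mul_nonneg (mul_nonneg (hp0 r) (add_nonneg (hk0 a r) (hh0 a r))) hu.1
        have h3 : ∑ r, q a r * p r ≤ ε / (2 * m) := ha
        linarith
      · have h1 : ∑ r, p r * q a r * udm a ≤ ∑ r, p r * (k a r + h a r) * udm a :=
          Finset.sum_le_sum fun r _ => by
            refine mul_le_mul_of_nonneg_right (mul_le_mul_of_nonneg_left ?_ (hp0 r)) hu.1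
            simpa [k, ha] using hh0 a r
        linarith
    have hm' : (m : ℝ) ≠ 0 := by
      have : m ≠ 0 := by omega
      exact_mod_cast this
    have htot : ∑ _a : A, ε / (2 * m) = ε / 2 := by
      rw [Finset.sum_const, Finset.card_univ, hm, nsmul_eq_mul]
      field_simp
    rw [← htot, ← Finset.sum_sub_distrib]
    exact Finset.sum_le_sum fun a _ => hloss a
  · by_cases ha : S a
    · refine Or.inr fun r hr a' => ?_
      by_cases hab : a = b r
      · exact hab ▸ hb r a'
      · simp [k, h, ha, hab] at hr
    · refine Or.inl ((not_le.1 ha).trans_le (Finset.sum_le_sum fun r _ => ?_))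
      refine mul_le_mul_of_nonneg_right ?_ (hp0 r)
      simpa [k, ha] using hh0 a r
end
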